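/- Let P be a probability measure supported on [a,b] with 0 < a < b < ∞. For φ > 0 let μ₀(φ) be the unique solution in (-a,∞) of 1 = φ ∫ (r/(μ₀+r))² dP(r) and define λ_min(φ) = μ₀(φ)·(1 - φ ∫ r/(μ₀(φ)+r) dP(r)). Then λ_min(φ) ≤ 0 for all φ > 0, with equality if and only if φ = 1. -/

import Mathlib

open MeasureTheory

lemma integral_lt_integral_of_ae_lt {α : Type*} [MeasurableSpace α] {μ : Measure α} [NeZero μ]
    {f g : α → ℝ} (hf : Integrable f μ) (hg : Integrable g μ) (h : ∀ᵐ x ∂μ, f x < g x) :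
    ∫ x, f x ∂μ < ∫ x, g x ∂μ := by
  refine lt_of_le_of_ne (integral_mono_ae hf hg (h.mono fun _ hx => hx.le)) fun heq => ?_
  have hfg := (integral_eq_iff_of_ae_le hf hg (h.mono fun _ hx => hx.le)).1 heq
  obtain ⟨x, hlt, hx⟩ := (h.and hfg).exists
  exact hlt.ne hx

lemma integrable_div_add_pow {a b m : ℝ} (ha : 0 < a) (hm : -a < m) {P : Measure ℝ}
    [IsFiniteMeasure P] (hsupp : ∀ᵐ r ∂P, r ∈ Set.Icc a b) (n : ℕ) :
    Integrable (fun r => (r / (m + r)) ^ n) P := by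
  refine Integrable.of_bound (C := (b / (m + a)) ^ n)
    (by fun_prop : Measurable fun r : ℝ => (r / (m + r)) ^ n).aestronglyMeasurable ?_
  filter_upwards [hsupp] with r ⟨har, hrb⟩
  have hma : 0 < m + a := by linarith
  have hmr : 0 < m + r := by linarith
  have hr : 0 < r := ha.trans_le har
  rw [Real.norm_of_nonneg (by positivity)]
  gcongr
  linarith

/-- The minimum ridge penalty `λ_min(φ) = μ₀(φ)(1 - φ∫ r/(μ₀(φ)+r) dP)` is
non-positive for all `φ > 0`, with equality iff `φ = 1`. -/
theorem lambda_min_nonpos (a b : ℝ) (ha : 0 < a) (hab : a < b)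
    (P : Measure ℝ) [IsProbabilityMeasure P]
    (hsupp : ∀ᵐ r ∂P, r ∈ Set.Icc a b)
    (μ₀ : ℝ → ℝ)
    (hμ₀ : ∀ φ : ℝ, 0 < φ →
      -a < μ₀ φ ∧ 1 = φ * ∫ r, (r / (μ₀ φ + r)) ^ 2 ∂P) :
    ∀ φ : ℝ, 0 < φ →
      μ₀ φ * (1 - φ * ∫ r, r / (μ₀ φ + r) ∂P) ≤ 0 ∧
      (μ₀ φ * (1 - φ * ∫ r, r / (μ₀ φ + r) ∂P) = 0 ↔ φ = 1) := by
  intro φ hφ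
  obtain ⟨hm, heq⟩ := hμ₀ φ hφ
  generalize μ₀ φ = m at hm heq ⊢
  have hint₁ : Integrable (fun r => r / (m + r)) P := by
    simpa using integrable_div_add_pow ha hm hsupp 1
  have hint₂ := integrable_div_add_pow ha hm hsupp 2
  have hone : ∫ _, (1 : ℝ) ∂P = 1 := by simp
  rcases lt_trichotomy m 0 with hneg | rfl | hpos
  · have hgt : ∀ᵐ r ∂P, 1 < r / (m + r) := by
      filter_upwards [hsupp] with r ⟨har, _⟩
      rw [one_lt_div (by linarith)]
      linarith
    have h₁ := integral_lt_integral_of_ae_lt hint₁ hint₂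
      (hgt.mono fun r hr => by nlinarith)
    have h₂ := integral_lt_integral_of_ae_lt (integrable_const 1) hint₁ hgt
    rw [hone] at h₂
    have hlt : m * (1 - φ * ∫ r, r / (m + r) ∂P) < 0 :=
      mul_neg_of_neg_of_pos hneg (by linarith [mul_lt_mul_of_pos_left h₁ hφ])
    refine ⟨hlt.le, fun h => absurd h hlt.ne, ?_⟩
    rintro rfl
    linarith
  · have hae : ∀ᵐ r ∂P, (r / (0 + r)) ^ 2 = 1 := by
      filter_upwards [hsupp] with r ⟨har, _⟩
      rw [zero_add, div_self (ha.trans_le har).ne', one_pow]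
    rw [integral_congr_ae hae, hone, mul_one] at heq
    simp [heq.symm]
  · have hlt₁ : ∀ᵐ r ∂P, 0 < r / (m + r) ∧ r / (m + r) < 1 := by
      filter_upwards [hsupp] with r ⟨har, _⟩
      have hr : 0 < r := ha.trans_le har
      refine ⟨by positivity, ?_⟩
      rw [div_lt_one (by positivity)]
      linarith
    have h₁ := integral_lt_integral_of_ae_lt hint₂ hint₁
      (hlt₁.mono fun r hr => by nlinarith [hr.1, hr.2])
    have h₂ := integral_lt_integral_of_ae_lt hint₁ (integrable_const 1)
      (hlt₁.mono fun _ hr => hr.2)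
    rw [hone] at h₂
    have hlt : m * (1 - φ * ∫ r, r / (m + r) ∂P) < 0 :=
      mul_neg_of_pos_of_neg hpos (by linarith [mul_lt_mul_of_pos_left h₁ hφ])
    refine ⟨hlt.le, fun h => absurd h hlt.ne, ?_⟩
    rintro rfl
    linarith
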